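/- Let H be a finitely generated subgroup of PSL(2,ℝ) whose underlying set is dense in PSL(2,ℝ). Then for every neighborhood U of the identity in PSL(2,ℝ) there exist elements a, b ∈ H with a ∈ U and b ∈ U that generate a free group of rank 2; that is, the group homomorphism from the free group on two generators to PSL(2,ℝ) sending the two generators to a and b respectively is injective. -/

import Mathlib

/-- `SL(2,ℝ)`. -/
abbrev SL2R := Matrix.SpecialLinearGroup (Fin 2) ℝ

/-- The topology on `SL(2,ℝ)` induced from the 2×2 real matrices. -/
noncomputable instance : TopologicalSpace SL2R :=
  TopologicalSpace.induced (fun g => (g : Matrix (Fin 2) (Fin 2) ℝ)) inferInstance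

/-- `PSL(2,ℝ)` as the quotient of `SL(2,ℝ)` by its center. -/
abbrev PSL2R := SL2R ⧸ Subgroup.center SL2R

section AbsVal
open Cardinal Polynomial

theorem countable_ratPoly : Countable ℚ[X] := by
  rw [← Cardinal.mk_le_aleph0_iff]
  exact Polynomial.cardinalMk_le_max.trans (by simp)

/-- Extending an embedding of a countable base to an uncountable algebraically closed field. -/
theorem exists_hom_of_countable (R : Type) [CommRing R] [Countable R] (K L : Type) [Field K] [Field L]
    [Algebra R K] [Algebra R L] (hRK : Function.Injective (algebraMap R K))
    (hRL : Function.Injective (algebraMap R L))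
    [IsAlgClosed K] [IsAlgClosed L] (hK : #K = 𝔠) (hL : #L = 𝔠) :
    ∃ f : K →+* L, ∀ r, f (algebraMap R K r) = algebraMap R L r := by
  have : Nontrivial R := RingHom.domain_nontrivial (algebraMap R K)
  have : FaithfulSMul R K := (faithfulSMul_iff_algebraMap_injective R K).2 hRK
  have : FaithfulSMul R L := (faithfulSMul_iff_algebraMap_injective R L).2 hRL
  obtain ⟨s, hs⟩ := exists_isTranscendenceBasis R K
  obtain ⟨t, ht⟩ := exists_isTranscendenceBasis R L
  have h1 := IsAlgClosed.cardinal_eq_cardinal_transcendence_basis_of_aleph0_lt' _ hs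
    (Cardinal.mk_le_aleph0) (by rw [hK]; exact aleph0_lt_continuum)
  have h2 := IsAlgClosed.cardinal_eq_cardinal_transcendence_basis_of_aleph0_lt' _ ht
    (Cardinal.mk_le_aleph0) (by rw [hL]; exact aleph0_lt_continuum)
  obtain ⟨e⟩ : Nonempty (s ≃ t) := Cardinal.eq.1 (by rw [← h1, ← h2, hK, hL])
  let v : s → K := Subtype.val
  let w : s → L := fun i => (e i : L)
  have hw : AlgebraicIndependent R w := ht.1.comp e e.injective
  let A := Algebra.adjoin R (Set.range v)
  let g : A →ₐ[R] L := (MvPolynomial.aeval w).comp (hs.1.aevalEquiv.symm : A →ₐ[R] MvPolynomial s R)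
  have hg : Function.Injective g := by
    have : Function.Injective (MvPolynomial.aeval w : MvPolynomial s R →ₐ[R] L) := hw
    exact this.comp hs.1.aevalEquiv.symm.injective
  let _ : Algebra A L := g.toRingHom.toAlgebra
  have : FaithfulSMul A L := (faithfulSMul_iff_algebraMap_injective A L).2 hg
  have : Algebra.IsAlgebraic A K := hs.isAlgebraic
  let f : K →ₐ[A] L := IsAlgClosed.lift
  refine ⟨f, fun r => ?_⟩
  have h3 : algebraMap R K r = algebraMap A K (algebraMap R A r) := rfl
  have h4 : algebraMap A L (algebraMap R A r) = algebraMap R L r := g.commutes r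
  rw [h3]
  exact (f.commutes _).trans h4

theorem exists_hom_of_algebraic (L : Type) [Field L] [CharZero L] [IsAlgClosed L] (hL : #L = 𝔠)
    (z : ℂ) (hz : IsAlgebraic ℚ z) (y : L) (hy : aeval y (minpoly ℚ z) = 0) :
    ∃ f : ℂ →+* L, f z = y := by
  have hzi : IsIntegral ℚ z := hz.isIntegral
  have : Fact (Irreducible (minpoly ℚ z)) := ⟨minpoly.irreducible hzi⟩
  let F := AdjoinRoot (minpoly ℚ z)
  have := countable_ratPoly
  have : Countable F := AdjoinRoot.mk_surjective.countable
  let i1 : F →ₐ[ℚ] ℂ := AdjoinRoot.liftAlgHom _ (Algebra.ofId ℚ ℂ) z (minpoly.aeval ℚ z)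
  let i2 : F →ₐ[ℚ] L := AdjoinRoot.liftAlgHom _ (Algebra.ofId ℚ L) y hy
  let _ : Algebra F ℂ := i1.toRingHom.toAlgebra
  let _ : Algebra F L := i2.toRingHom.toAlgebra
  obtain ⟨f, hf⟩ := exists_hom_of_countable F ℂ L i1.toRingHom.injective i2.toRingHom.injective
    mk_complex hL
  refine ⟨f, ?_⟩
  have := hf (AdjoinRoot.root _)
  have h1 : i1 (AdjoinRoot.root _) = z := AdjoinRoot.liftAlgHom_root ..
  have h2 : i2 (AdjoinRoot.root _) = y := AdjoinRoot.liftAlgHom_root ..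
  change f (i1 _) = i2 _ at this
  rwa [h1, h2] at this

theorem exists_hom_of_transcendental (z : ℂ) (hz : Transcendental ℚ z) (y : ℂ)
    (hy : Transcendental ℚ y) : ∃ f : ℂ →+* ℂ, f z = y := by
  let F := ℚ[X]
  let i1 : F →ₐ[ℚ] ℂ := aeval z
  let i2 : F →ₐ[ℚ] ℂ := aeval y
  have : Countable F := countable_ratPoly
  obtain ⟨f, hf⟩ := @exists_hom_of_countable F _ _ ℂ ℂ _ _ i1.toRingHom.toAlgebra
    i2.toRingHom.toAlgebra (transcendental_iff_injective.1 hz) (transcendental_iff_injective.1 hy) 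
    _ _ mk_complex mk_complex
  refine ⟨f, ?_⟩
  have := hf X
  have h1 : i1 X = z := aeval_X z
  have h2 : i2 X = y := aeval_X y
  change f (i1 X) = i2 X at this
  rwa [h1, h2] at this

theorem mk_padicAlgCl (p : ℕ) [Fact p.Prime] : #(PadicAlgCl p) = 𝔠 := by
  have h1 : 𝔠 ≤ #ℚ_[p] := continuum_le_cardinal_of_nontriviallyNormedField _
  have h2 : #ℚ_[p] ≤ 𝔠 := by
    have : #(CauSeq ℚ (padicNorm p)) ≤ 𝔠 := by
      calc #(CauSeq ℚ (padicNorm p)) ≤ #(ℕ → ℚ) := Cardinal.mk_le_of_injective Subtype.val_injective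
        _ = 𝔠 := by simp
    refine le_trans ?_ this
    exact Cardinal.mk_le_of_surjective (f := CauSeq.Completion.mk) Quotient.mk_surjective
  apply le_antisymm
  · have := Algebra.IsAlgebraic.cardinalMk_le_max ℚ_[p] (PadicAlgCl p)
    refine this.trans (max_le h2 aleph0_le_continuum)
  · exact h1.trans (Cardinal.mk_le_of_injective (algebraMap ℚ_[p] (PadicAlgCl p)).injective)


theorem den_eq_one_of_padic (q : ℚ) (h : ∀ (p : ℕ) [Fact p.Prime], ‖(q : ℚ_[p])‖ ≤ 1) :
    q.den = 1 := by
  by_contra hne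
  obtain ⟨p, hp, hpd⟩ := Nat.exists_prime_and_dvd hne
  have : Fact p.Prime := ⟨hp⟩
  have h1 := h p
  have h2 : ‖((q.den : ℤ) : ℚ_[p])‖ < 1 :=
    Padic.norm_intCast_lt_one_iff.2 (by exact_mod_cast hpd)
  have h3 : (q : ℚ_[p]) * ((q.den : ℤ) : ℚ_[p]) = ((q.num : ℤ) : ℚ_[p]) := by
    have := Rat.mul_den_eq_num q
    exact_mod_cast congrArg (fun x : ℚ => (x : ℚ_[p])) this
  have h4 : ‖((q.num : ℤ) : ℚ_[p])‖ < 1 := by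
    rw [← h3, norm_mul]
    nlinarith [norm_nonneg (q : ℚ_[p]), norm_nonneg ((q.den : ℤ) : ℚ_[p])]
  have h5 : (p : ℤ) ∣ q.num := Padic.norm_intCast_lt_one_iff.1 h4
  have h6 : p ∣ q.num.natAbs := by rwa [← Int.natCast_dvd]
  exact Nat.Prime.not_coprime_iff_dvd.2 ⟨p, hp, h6, hpd⟩ q.reduced

theorem exists_padic_root (z : ℂ) (hz : IsAlgebraic ℚ z) (hzi : ¬ IsIntegral ℤ z) :
    ∃ (p : ℕ) (_ : Fact p.Prime) (y : PadicAlgCl p), aeval y (minpoly ℚ z) = 0 ∧ 1 < ‖y‖ := by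
  by_contra! hcon
  apply hzi
  have hmon : (minpoly ℚ z).Monic := minpoly.monic hz.isIntegral
  have hden : ∀ i, ((minpoly ℚ z).coeff i).den = 1 := by
    intro i
    apply den_eq_one_of_padic
    intro p hp
    let O : Subring (PadicAlgCl p) :=
      { carrier := {x | ‖x‖ ≤ 1}
        mul_mem' := fun {a b} ha hb => by
          simp only [Set.mem_ofPred_eq] at *
          rw [norm_mul]; exact mul_le_one₀ ha (norm_nonneg _) hb
        one_mem' := by simp
        add_mem' := fun {a b} ha hb =>
          (IsUltrametricDist.norm_add_le_max a b).trans (max_le ha hb)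
        zero_mem' := by simp
        neg_mem' := fun {a} ha => by simpa using ha }
    have hsp : ((minpoly ℚ z).map (algebraMap ℚ (PadicAlgCl p))).Splits := IsAlgClosed.splits _
    have hprod := hsp.eq_prod_roots_of_monic (hmon.map _)
    have hl : (minpoly ℚ z).map (algebraMap ℚ (PadicAlgCl p)) ∈ lifts O.subtype := by
      rw [hprod]
      apply multiset_prod_mem
      intro f hf
      obtain ⟨y, hy, rfl⟩ := Multiset.mem_map.1 hf
      have hy' : aeval y (minpoly ℚ z) = 0 := by
        have := (mem_roots'.1 hy).2
        rwa [IsRoot.def, eval_map_algebraMap] at this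
      rw [mem_lifts]
      exact ⟨X - C ⟨y, hcon p hp y hy'⟩, by simp⟩
    obtain ⟨q, hq⟩ := (mem_lifts _).1 hl
    have h1 : (O.subtype (q.coeff i)) = algebraMap ℚ (PadicAlgCl p) ((minpoly ℚ z).coeff i) := by
      rw [← coeff_map, hq, coeff_map]
    have h2 : ‖O.subtype (q.coeff i)‖ ≤ 1 := (q.coeff i).2
    rw [h1, ← PadicAlgCl.norm_extends] at *
    convert h2 using 2
    simp
  have hl : minpoly ℚ z ∈ lifts (Int.castRingHom ℚ) := by
    rw [lifts_iff_coeff_lifts]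
    intro i
    exact ⟨((minpoly ℚ z).coeff i).num, (Rat.den_eq_one_iff _).1 (hden i)⟩
  obtain ⟨q, hq, -, hqm⟩ := lifts_and_natDegree_eq_and_monic hl hmon
  refine ⟨q, hqm, ?_⟩
  have h := minpoly.aeval ℚ z
  rw [← hq, aeval_def, eval₂_map] at h
  have h2 : algebraMap ℤ ℂ = (algebraMap ℚ ℂ).comp (Int.castRingHom ℚ) := RingHom.ext_int _ _
  rw [h2]
  exact h

/-- A nonzero complex number that is not a root of unity has absolute value `≠ 1`
for a suitable absolute value on `ℂ`. -/
theorem exists_absoluteValue (z : ℂ) (hz0 : z ≠ 0) (hz : ∀ n : ℕ, 0 < n → z ^ n ≠ 1) :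
    ∃ v : AbsoluteValue ℂ ℝ, 1 < v z := by
  have key : ∀ (L : Type) [NormedField L] (f : ℂ →+* L), 1 < ‖f z‖ →
      ∃ v : AbsoluteValue ℂ ℝ, 1 < v z := by
    intro L _ f hf
    exact ⟨(NormedField.toAbsoluteValue L).comp f.injective, hf⟩
  by_cases ht : Transcendental ℚ z
  · by_cases h1 : 1 < ‖z‖
    · exact key ℂ (RingHom.id ℂ) h1
    obtain ⟨n, hn⟩ := exists_nat_gt (1 / ‖z‖)
    have hzp : 0 < ‖z‖ := norm_pos_iff.2 hz0
    have hn0 : (n : ℚ) ≠ 0 := by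
      rintro h
      have : (n : ℝ) = 0 := by exact_mod_cast h
      rw [this] at hn
      exact absurd hn (not_lt.2 (by positivity))
    have ht2 : Transcendental ℚ ((n : ℂ) * z) := by
      intro h
      apply ht
      have h2 := (isAlgebraic_algebraMap (R := ℚ) (A := ℂ) ((n : ℚ)⁻¹)).mul h
      have : (algebraMap ℚ ℂ) ((n : ℚ)⁻¹) * (n * z) = z := by
        have : (n : ℂ) ≠ 0 := by exact_mod_cast hn0
        simp; field_simp
      rwa [this] at h2
    obtain ⟨f, hf⟩ := exists_hom_of_transcendental z ht _ ht2
    refine key ℂ f ?_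
    rw [hf, norm_mul, Complex.norm_natCast]
    rwa [div_lt_iff₀ hzp] at hn
  have hza : IsAlgebraic ℚ z := by
    by_contra h; exact ht h
  by_cases hi : IsIntegral ℤ z
  · by_contra hcon
    have hnf : NumberField (IntermediateField.adjoin ℚ {z}) :=
      { to_charZero := inferInstance
        to_finiteDimensional := IntermediateField.adjoin.finiteDimensional hza.isIntegral }
    let x : IntermediateField.adjoin ℚ {z} := IntermediateField.AdjoinSimple.gen ℚ z
    obtain ⟨n, hn, hx⟩ := NumberField.Embeddings.pow_eq_one_of_norm_le_one
      (IntermediateField.adjoin ℚ {z}) ℂ (x := x) (fun h => hz0 (congrArg Subtype.val h))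
      (by
        exact (isIntegral_algHom_iff
          ((IntermediateField.adjoin ℚ {z}).val.restrictScalars ℤ) Subtype.val_injective).1 hi) (by
        intro φ
        by_contra! hφ
        apply hcon
        obtain ⟨f, hf⟩ := exists_hom_of_algebraic ℂ mk_complex z hza (φ x) (by
          have h1 : aeval x (minpoly ℚ z) = 0 := by
            apply Subtype.val_injective
            have := (aeval_algHom_apply (IntermediateField.adjoin ℚ {z}).val x (minpoly ℚ z)).symm
            exact this.trans (minpoly.aeval ℚ z)
          have := aeval_algHom_apply φ.toRatAlgHom x (minpoly ℚ z)
          rw [h1, map_zero] at this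
          exact this)
        exact key ℂ f (by rwa [hf]))
    exact hz n hn (congrArg Subtype.val hx)
  · obtain ⟨p, hp, y, hy, hy1⟩ := exists_padic_root z hza hi
    obtain ⟨f, hf⟩ := exists_hom_of_algebraic (PadicAlgCl p) (mk_padicAlgCl p) z hza y hy
    exact key _ f (by rwa [hf])

end AbsVal

theorem eq_one_of_congruent {A k : Type} [CommRing A] [IsDomain A] [Field k] (φ : A →+* k) (p : ℕ)
    [CharP k p] (x : Matrix.SpecialLinearGroup (Fin 2) A)
    (hx : Matrix.SpecialLinearGroup.map φ x = 1) (N : ℕ) (hN : ¬ p ∣ N) (hxN : x ^ N = 1) :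
    x = 1 := by
  let X : Matrix (Fin 2) (Fin 2) A := x
  have hX : X ^ N = 1 := by
    have := congrArg (fun y : Matrix.SpecialLinearGroup (Fin 2) A => y.1) hxN
    simpa [X] using this
  have hφ : φ.mapMatrix X = 1 := by
    have := congrArg (fun y : Matrix.SpecialLinearGroup (Fin 2) k => y.1) hx
    simpa [X] using this
  let S : Matrix (Fin 2) (Fin 2) A := ∑ i ∈ Finset.range N, X ^ i
  have hS : S * (X - 1) = 0 := by
    rw [geom_sum_mul, hX, sub_self]
  have hφS : φ.mapMatrix S = (N : Matrix (Fin 2) (Fin 2) k) := by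
    simp only [S, map_sum, map_pow, hφ, one_pow]
    simp
  have hdet : S.det ≠ 0 := by
    intro h
    have h1 : (φ.mapMatrix S).det = 0 := by
      rw [← RingHom.map_det, h, map_zero]
    rw [hφS] at h1
    have h2 : (N : k) = 0 := by
      rw [Matrix.det_fin_two] at h1
      simpa [Matrix.natCast_apply] using h1
    exact hN ((CharP.cast_eq_zero_iff k p N).1 h2)
  have h3 : S.det • (X - 1) = 0 := by
    rw [← Matrix.one_mul (X - 1), ← Matrix.smul_mul, ← Matrix.adjugate_mul, Matrix.mul_assoc, hS,
      Matrix.mul_zero]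
  have h4 : X - 1 = 0 := by
    rcases smul_eq_zero.1 h3 with h | h
    · exact absurd h hdet
    · exact h
  apply Subtype.ext
  exact sub_eq_zero.1 h4

theorem isJacobsonRing_int : IsJacobsonRing ℤ := by
  rw [isJacobsonRing_iff_prime_eq]
  intro P hP
  by_cases h : P = ⊥
  · subst h
    rw [eq_bot_iff]
    intro x hx
    have h1 := Ideal.mem_jacobson_bot.1 hx x
    rw [Int.isUnit_iff] at h1
    have h2 : x * x = 0 := by
      rcases h1 with h1 | h1 <;> nlinarith [mul_self_nonneg x]
    simpa using h2
  · have := hP.isMaximal h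
    exact Ideal.jacobson_eq_self_of_isMaximal

theorem torsion_prime (A : Subalgebra ℤ ℝ) (hA : A.FG) :
    ∃ p : ℕ, p.Prime ∧ (∀ x ∈ A, x * (p : ℝ) ≠ 1) ∧ ∃ M : ℕ, 0 < M ∧
      ∀ g : SL2R, (∀ i j, g i j ∈ A) → ∀ N, ¬ p ∣ N → g ^ N = 1 → g ^ M = 1 := by
  have hft : Algebra.FiniteType ℤ A := (Subalgebra.fg_iff_finiteType A).1 hA
  obtain ⟨m, hm⟩ := Ideal.exists_maximal A
  let k := A ⧸ m
  let _ : Field k := Ideal.Quotient.field m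
  have := isJacobsonRing_int
  have hfin : Module.Finite ℤ k := finite_of_finite_type_of_isJacobsonRing ℤ k
  obtain ⟨p, hp⟩ := CharP.exists k
  have hp0 : p ≠ 0 := by
    rintro rfl
    have : CharZero k := CharP.charP_to_charZero k
    have hinj : Function.Injective (algebraMap ℤ k) := Int.cast_injective
    have : IsField ℤ := isField_of_isIntegral_of_isField hinj (Field.toIsField k)
    exact Int.not_isField this
  have hpp : p.Prime := (CharP.char_is_prime_or_zero k p).resolve_right hp0
  have : Fact p.Prime := ⟨hpp⟩
  have hfink : Finite k := by
    let _ : Algebra (ZMod p) k := ZMod.algebra k p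
    have : Module.Finite (ZMod p) k := Module.Finite.of_restrictScalars_finite ℤ (ZMod p) k
    exact Module.finite_of_finite (ZMod p)
  let φ : A →+* k := Ideal.Quotient.mk m
  refine ⟨p, hpp, ?_, Nat.card (Matrix.SpecialLinearGroup (Fin 2) k), Nat.card_pos, ?_⟩
  · intro x hx h
    have h1 : (⟨x, hx⟩ : A) * (p : A) = 1 := Subtype.ext (by simpa using h)
    have h2 := congrArg φ h1
    simp at h2
  · intro g hg N hN hgN
    let ι : A →+* ℝ := A.val.toRingHom
    have hι : Function.Injective ι := Subtype.val_injective
    let y : Matrix.SpecialLinearGroup (Fin 2) A := ⟨Matrix.of fun i j => ⟨g i j, hg i j⟩, by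
      apply hι
      rw [RingHom.map_det]
      rw [map_one]
      exact g.2⟩
    have hy : Matrix.SpecialLinearGroup.map ι y = g := by
      apply Subtype.ext
      ext i j
      rfl
    have hinj : Function.Injective (Matrix.SpecialLinearGroup.map (n := Fin 2) ι) := by
      intro a b hab
      apply Subtype.ext
      ext i j
      have := congrArg (fun z : SL2R => z i j) hab
      exact Subtype.ext_iff.1 (hι this)
    have hyN : y ^ N = 1 := hinj (by rw [map_pow, hy, hgN, map_one])
    have : y ^ Nat.card (Matrix.SpecialLinearGroup (Fin 2) k) = 1 := by
      refine eq_one_of_congruent φ p _ ?_ N hN ?_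
      · rw [map_pow, pow_card_eq_one']
      · rw [← pow_mul, mul_comm, pow_mul, hyN, one_pow]
    rw [← hy, ← map_pow, this, map_one]

theorem bounded_torsion (A : Subalgebra ℤ ℝ) (hA : A.FG) :
    ∃ M : ℕ, 0 < M ∧
      ∀ g : SL2R, (∀ i j, g i j ∈ A) → ∀ N, 0 < N → g ^ N = 1 → g ^ M = 1 := by
  obtain ⟨p, hp, hpA, M, hM, h1⟩ := torsion_prime A hA
  let B : Subalgebra ℤ ℝ := A ⊔ Algebra.adjoin ℤ {(p : ℝ)⁻¹}
  have hB : B.FG := hA.sup ⟨{(p : ℝ)⁻¹}, by simp⟩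
  obtain ⟨q, hq, hqB, M', hM', h2⟩ := torsion_prime B hB
  have hpq : q ≠ p := by
    rintro rfl
    refine hqB (q : ℝ)⁻¹ ?_ ?_
    · exact (le_sup_right : _ ≤ B) (Algebra.subset_adjoin rfl)
    · have : (q : ℝ) ≠ 0 := by exact_mod_cast hq.ne_zero
      field_simp
  refine ⟨M * M', by positivity, fun g hg N hN hgN => ?_⟩
  obtain ⟨e, n, hn, rfl⟩ := Nat.exists_eq_pow_mul_and_not_dvd hN.ne' p hp.ne_one
  have hpow : ∀ n, ∀ i j, (g ^ n) i j ∈ A := by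
    intro n
    induction n with
    | zero =>
      intro i j
      by_cases h : i = j
      · subst h; simp
      · simp [Matrix.one_apply_ne h]
    | succ n ih =>
      intro i j
      rw [pow_succ, Matrix.SpecialLinearGroup.coe_mul, Matrix.mul_apply]
      exact A.sum_mem fun l _ => A.mul_mem (ih _ _) (hg _ _)
  have h3 : (g ^ p ^ e) ^ M = 1 := h1 _ (hpow _) n hn (by rw [← pow_mul, hgN])
  have h4 : (g ^ M) ^ p ^ e = 1 := by rw [← pow_mul, mul_comm, pow_mul, h3]
  have h5 := h2 (g ^ M) (fun i j => (le_sup_left : A ≤ B) (hpow M i j)) (p ^ e)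
    (fun h => hpq ((Nat.prime_dvd_prime_iff_eq hq hp).1 (hq.dvd_of_dvd_pow h))) h4
  rw [pow_mul, h5]

open scoped Pointwise Function in
/-- Ping-pong with norms of linear forms. -/
theorem free_of_forms {G α : Type} [Group G] [MulAction G α] [Nonempty α]
    (N : Bool → Bool → α → ℝ) (hN0 : ∀ i s x, 0 ≤ N i s x)
    (hpos : ∀ i x, 0 < N i true x + N i false x) (a : Bool → G) (t : ℝ) (ht0 : 0 < t)
    (hP : ∀ i x, N i true (a i • x) = t * N i true x)
    (hQ : ∀ i x, N i false (a i • x) = t⁻¹ * N i false x) (C : ℝ)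
    (hC : ∀ i s s' x, N i s x ≤ C * (N i (!s) x + N (!i) s' x))
    (R : ℝ) (hR1 : 1 ≤ R) (hRC : 2 * C ≤ R) (htR : R < t) :
    Function.Injective (FreeGroup.lift a) := by
  let X : Bool → Set α := fun i => {x | R * N i false x < N i true x}
  let Y : Bool → Set α := fun i => {x | R * N i true x < N i false x}
  have hP' : ∀ i x, N i true ((a i)⁻¹ • x) = t⁻¹ * N i true x := by
    intro i x
    have := hP i ((a i)⁻¹ • x)
    rw [smul_inv_smul] at this
    rw [this]; field_simp
  have hQ' : ∀ i x, N i false ((a i)⁻¹ • x) = t * N i false x := by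
    intro i x
    have := hQ i ((a i)⁻¹ • x)
    rw [smul_inv_smul] at this
    rw [this]; field_simp
  have hdis : ∀ i s s' x, R * N i (!s) x < N i s x → R * N (!i) s' x < N (!i) (!s') x → False := by
    intro i s s' x h1 h2
    have h3 := hC i s s' x
    have h4 := hC (!i) (!s') (!s) x
    simp only [Bool.not_not] at h4
    nlinarith [mul_nonneg (sub_nonneg.2 hRC) (add_nonneg (hN0 i (!s) x) (hN0 (!i) s' x))]
  have hne : ∀ i j : Bool, i ≠ j → j = !i := by decide
  have hXd : Pairwise (Disjoint on X) := by
    intro i j hij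
    obtain rfl := hne i j hij
    exact Set.disjoint_left.2 fun x h1 h2 => hdis i true false x h1 h2
  have hYd : Pairwise (Disjoint on Y) := by
    intro i j hij
    obtain rfl := hne i j hij
    exact Set.disjoint_left.2 fun x h1 h2 => hdis i false true x h1 h2
  have hXY : ∀ i j, Disjoint (X i) (Y j) := by
    intro i j
    refine Set.disjoint_left.2 fun x h1 h2 => ?_
    by_cases hij : i = j
    · subst hij
      change R * N i false x < N i true x at h1
      change R * N i true x < N i false x at h2
      nlinarith [hN0 i true x, hN0 i false x]
    · obtain rfl := hne i j hij
      exact hdis i true true x h1 h2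
  have key : ∀ p q : ℝ, 0 ≤ p → 0 ≤ q → 0 < p + q → q ≤ R * p → R * (t⁻¹ * q) < t * p := by
    intro p q hp hq hpq h
    have hp' : 0 < p := by
      rcases hp.lt_or_eq with h1 | h1
      · exact h1
      · subst h1; linarith
    have h1 : R * (t⁻¹ * q) = (R * q) / t := by field_simp
    rw [h1, div_lt_iff₀ ht0]
    have h2 : R * q ≤ R * (R * p) := by gcongr
    have h3 : R * R < t * t := by nlinarith
    nlinarith
  have hX : ∀ i, ∀ x, x ∉ Y i → a i • x ∈ X i := by
    intro i x hx
    change R * N i false (a i • x) < N i true (a i • x)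
    rw [hP, hQ]
    exact key _ _ (hN0 _ _ _) (hN0 _ _ _) (hpos i x) (not_lt.1 hx)
  have hY : ∀ i, ∀ x, x ∉ X i → (a i)⁻¹ • x ∈ Y i := by
    intro i x hx
    change R * N i true ((a i)⁻¹ • x) < N i false ((a i)⁻¹ • x)
    rw [hP', hQ']
    exact key _ _ (hN0 _ _ _) (hN0 _ _ _) (by linarith [hpos i x]) (not_lt.1 hx)
  refine FreeGroup.injective_lift_of_ping_pong a X Y ?_ hXd hYd hXY ?_ ?_
  · intro i
    obtain ⟨x⟩ := ‹Nonempty α›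
    by_cases hx : x ∈ Y i
    · have h1 : x ∉ Y (!i) := fun h => hdis i false true x hx h
      exact ⟨_, hX i _ (Set.disjoint_left.1 (hXY (!i) i) (hX _ _ h1))⟩
    · exact ⟨_, hX i x hx⟩
  · rintro i _ ⟨x, hx, rfl⟩
    exact hX i x hx
  · rintro i _ ⟨x, hx, rfl⟩
    exact hY i x hx

theorem form_bound (v : AbsoluteValue ℂ ℝ) (x y z : ℂ × ℂ) (hD : y.1 * z.2 - y.2 * z.1 ≠ 0) :
    ∃ C : ℝ, ∀ w : Fin 2 → ℂ, v (x.1 * w 0 + x.2 * w 1) ≤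
      C * (v (y.1 * w 0 + y.2 * w 1) + v (z.1 * w 0 + z.2 * w 1)) := by
  set D := y.1 * z.2 - y.2 * z.1 with hDdef
  let α := (x.1 * z.2 - x.2 * z.1) / D
  let β := (y.1 * x.2 - y.2 * x.1) / D
  refine ⟨v α + v β, fun w => ?_⟩
  have h : x.1 * w 0 + x.2 * w 1 = α * (y.1 * w 0 + y.2 * w 1) + β * (z.1 * w 0 + z.2 * w 1) := by
    simp only [α, β]
    field_simp
    rw [hDdef]
    ring
  rw [h]
  refine (v.add_le _ _).trans ?_
  rw [v.map_mul, v.map_mul]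
  nlinarith [v.nonneg α, v.nonneg β, v.nonneg (y.1 * w 0 + y.2 * w 1),
    v.nonneg (z.1 * w 0 + z.2 * w 1), mul_nonneg (v.nonneg α) (v.nonneg (z.1 * w 0 + z.2 * w 1)),
    mul_nonneg (v.nonneg β) (v.nonneg (y.1 * w 0 + y.2 * w 1))]

/-- The underlying function of the action of `SL(2,ℝ)` on `ℂ²`. -/
noncomputable def actFun (g : SL2R) (w : Fin 2 → ℂ) : Fin 2 → ℂ :=
  ![(g 0 0 : ℂ) * w 0 + (g 0 1 : ℂ) * w 1, (g 1 0 : ℂ) * w 0 + (g 1 1 : ℂ) * w 1]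

theorem actFun_mul (g h : SL2R) (w : Fin 2 → ℂ) : actFun (g * h) w = actFun g (actFun h w) := by
  funext i
  fin_cases i <;> simp [actFun, Matrix.mul_apply, Fin.sum_univ_two] <;> ring

theorem actFun_one (w : Fin 2 → ℂ) : actFun 1 w = w := by
  funext i
  fin_cases i <;> simp [actFun]

/-- The action of `SL(2,ℝ)` on nonzero complex vectors. -/
@[reducible]
noncomputable def actC : MulAction SL2R {w : Fin 2 → ℂ // w ≠ 0} where
  smul g w := ⟨actFun g w.1, fun h => w.2 (by
    have h1 : actFun g⁻¹ (actFun g w.1) = w.1 := by rw [← actFun_mul, inv_mul_cancel, actFun_one]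
    rw [← h1, h]
    funext i
    fin_cases i <;> simp [actFun])⟩
  one_smul w := Subtype.ext (actFun_one w.1)
  mul_smul g h w := Subtype.ext (actFun_mul g h w.1)

theorem free_pow (a h : SL2R) (z : ℂ) (v : AbsoluteValue ℂ ℝ) (hv : 1 < v z)
    (hz : z * z - (a 0 0 + a 1 1) * z + 1 = 0) (hc : a 1 0 ≠ 0) (hzz : z ≠ z⁻¹)
    (hdet : ∀ m ∈ ({z, z⁻¹} : Set ℂ), ∀ m' ∈ ({z, z⁻¹} : Set ℂ),
      (a 1 0 : ℂ) * (-(a 1 0 : ℂ) * h 0 1 + (m' - a 0 0) * h 0 0) -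
        (m - a 0 0) * ((a 1 0 : ℂ) * h 1 1 - (m' - a 0 0) * h 1 0) ≠ 0) :
    ∃ n₀ : ℕ, ∀ n ≥ n₀, Function.Injective (FreeGroup.lift
      (fun x : Bool => if x then a ^ n else h * a ^ n * h⁻¹)) := by
  have hz0 : z ≠ 0 := by
    rintro rfl; simp at hz
  let μ : Bool → ℂ := fun s => if s then z else z⁻¹
  have hμ : ∀ s, μ s ∈ ({z, z⁻¹} : Set ℂ) := by intro s; cases s <;> simp [μ]
  have hμ0 : ∀ s, μ s * μ s - (a 0 0 + a 1 1) * μ s + 1 = 0 := by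
    intro s
    cases s
    · change z⁻¹ * z⁻¹ - (a 0 0 + a 1 1) * z⁻¹ + 1 = 0
      have : z⁻¹ * z⁻¹ * (z * z - (a 0 0 + a 1 1) * z + 1) = 0 := by rw [hz, mul_zero]
      rw [← this]
      field_simp
      ring
    · exact hz
  let k : Bool → SL2R := fun i => if i then 1 else h
  let ell : Bool → (Fin 2 → ℂ) → ℂ := fun s w => (a 1 0 : ℂ) * w 0 + (μ s - a 0 0) * w 1
  have hadet : (a 0 0 : ℂ) * a 1 1 - a 0 1 * a 1 0 = 1 := by
    have := a.2
    rw [Matrix.det_fin_two] at this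
    exact_mod_cast this
  have hell : ∀ s w, ell s (actFun a w) = μ s * ell s w := by
    intro s w
    simp only [ell, actFun, Matrix.cons_val_zero, Matrix.cons_val_one]
    linear_combination (-w 1) * hμ0 s - w 1 * hadet
  have hellpow : ∀ n s w, ell s (actFun (a ^ n) w) = μ s ^ n * ell s w := by
    intro n
    induction n with
    | zero => intro s w; simp [actFun_one]
    | succ n ih => intro s w; rw [pow_succ, actFun_mul, ih, hell, pow_succ]; ring
  let F : Bool → Bool → ℂ × ℂ := fun i s =>
    ((a 1 0 : ℂ) * (k i) 1 1 - (μ s - a 0 0) * (k i) 1 0,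
      -(a 1 0 : ℂ) * (k i) 0 1 + (μ s - a 0 0) * (k i) 0 0)
  have hF : ∀ i s w, ell s (actFun (k i)⁻¹ w) = (F i s).1 * w 0 + (F i s).2 * w 1 := by
    intro i s w
    simp only [ell, actFun, F, Matrix.SpecialLinearGroup.SL2_inv_expl, Matrix.cons_val_zero,
      Matrix.cons_val_one, Matrix.cons_val', Matrix.cons_val_fin_one]
    push_cast
    ring
  have hFd : ∀ i s s', (F i s).1 * (F (!i) s').2 - (F i s).2 * (F (!i) s').1 ≠ 0 := by
    have h1 : ∀ s s', (F true s).1 * (F false s').2 - (F true s).2 * (F false s').1 ≠ 0 := by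
      intro s s'
      have := hdet _ (hμ s) _ (hμ s')
      simpa [F, k] using this
    intro i s s'
    cases i
    · intro h2
      apply h1 s' s
      simp only [Bool.not_false] at h2
      linear_combination -h2
    · exact h1 s s'
  let N : Bool → Bool → {w : Fin 2 → ℂ // w ≠ 0} → ℝ := fun i s w =>
    v (ell s (actFun (k i)⁻¹ w.1))
  have hb : ∀ q : Bool × Bool × Bool, ∃ C : ℝ, ∀ w, N q.1 q.2.1 w ≤
      C * (N q.1 (!q.2.1) w + N (!q.1) q.2.2 w) := by
    rintro ⟨i, s, s'⟩
    obtain ⟨C, hC⟩ := form_bound v (F i s) (F i (!s)) (F (!i) s') (hFd i (!s) s')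
    refine ⟨C, fun w => ?_⟩
    simp only [N, hF]
    exact hC w.1
  choose C' hC' using hb
  have hN0 : ∀ i s x, 0 ≤ N i s x := fun i s x => v.nonneg _
  let C : ℝ := ∑ q, |C' q|
  have hC : ∀ i s s' x, N i s x ≤ C * (N i (!s) x + N (!i) s' x) := by
    intro i s s' x
    refine (hC' (i, s, s') x).trans ?_
    have h1 : C' (i, s, s') ≤ C := (le_abs_self _).trans
      (Finset.single_le_sum (f := fun q => |C' q|) (fun q _ => abs_nonneg _) (Finset.mem_univ _))
    exact mul_le_mul_of_nonneg_right h1 (add_nonneg (hN0 _ _ _) (hN0 _ _ _))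
  have hpos : ∀ i x, 0 < N i true x + N i false x := by
    intro i x
    by_contra hcon
    have h1 : N i true x = 0 := by linarith [hN0 i true x, hN0 i false x]
    have h2 : N i false x = 0 := by linarith [hN0 i true x, hN0 i false x]
    have h1 := v.eq_zero.1 h1
    have h2 := v.eq_zero.1 h2
    have hx : actFun (k i)⁻¹ x.1 ≠ 0 := (actC.toSMul.smul (k i)⁻¹ x).2
    generalize actFun (k i)⁻¹ x.1 = u at *
    simp only [ell, μ] at h1 h2
    have h3 : (z - z⁻¹) * u 1 = 0 := by
      simp at h1 h2
      linear_combination h1 - h2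
    have h4 : u 1 = 0 := (mul_eq_zero.1 h3).resolve_left (sub_ne_zero.2 hzz)
    rw [h4, mul_zero, add_zero] at h1
    have h5 : u 0 = 0 := (mul_eq_zero.1 h1).resolve_left (by exact_mod_cast hc)
    apply hx
    funext j
    fin_cases j
    · exact h5
    · exact h4
  let R := max 1 (2 * C)
  obtain ⟨n₀, hn₀⟩ := pow_unbounded_of_one_lt R hv
  refine ⟨n₀, fun n hn => ?_⟩
  let _ := actC
  have : Nonempty {w : Fin 2 → ℂ // w ≠ 0} := ⟨⟨fun _ => 1, fun h => one_ne_zero (congrFun h 0)⟩⟩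
  have ha : (fun x : Bool => if x then a ^ n else h * a ^ n * h⁻¹) =
      fun x => k x * a ^ n * (k x)⁻¹ := by
    funext x; cases x <;> simp [k]
  rw [ha]
  have hsc : ∀ i s (x : {w : Fin 2 → ℂ // w ≠ 0}),
      N i s ((k i * a ^ n * (k i)⁻¹) • x) = v (μ s) ^ n * N i s x := by
    intro i s x
    have : ((k i * a ^ n * (k i)⁻¹) • x).1 = actFun (k i * a ^ n * (k i)⁻¹) x.1 := rfl
    simp only [N]
    rw [this, ← actFun_mul, mul_assoc, inv_mul_cancel_left, actFun_mul, hellpow, v.map_mul,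
      v.map_pow]
  refine free_of_forms N hN0 hpos _ (v z ^ n) (by positivity) ?_ ?_ C hC R (le_max_left _ _)
    (le_max_right _ _) (hn₀.trans_le (pow_le_pow_right₀ hv.le hn))
  · intro i x
    exact hsc i true x
  · intro i x
    rw [hsc i false x]
    simp [μ]

theorem psl_free (a b : SL2R) (h : Function.Injective (FreeGroup.lift
      (fun x : Bool => if x then a else b))) :
    Function.Injective ⇑(FreeGroup.lift (fun x : Bool => if x then (QuotientGroup.mk a : PSL2R)
      else QuotientGroup.mk b) : FreeGroup Bool →* PSL2R) := by
  have hcomp : (FreeGroup.lift (fun x : Bool => if x then (QuotientGroup.mk a : PSL2R)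
      else QuotientGroup.mk b) : FreeGroup Bool →* PSL2R) =
      (QuotientGroup.mk' (Subgroup.center SL2R)).comp
        (FreeGroup.lift (fun x : Bool => if x then a else b)) := by
    ext x
    cases x <;> simp
  rw [hcomp, injective_iff_map_eq_one]
  intro w hw
  rw [MonoidHom.comp_apply, QuotientGroup.mk'_apply, QuotientGroup.eq_one_iff,
    Matrix.SpecialLinearGroup.mem_center_iff] at hw
  obtain ⟨r, hr, hw⟩ := hw
  have h1 : (FreeGroup.lift (fun x : Bool => if x then a else b) w) ^ 2 = 1 := by
    apply Subtype.ext
    rw [Matrix.SpecialLinearGroup.coe_pow, ← hw, ← map_pow]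
    simp at hr
    rcases hr with rfl | rfl <;> simp
  rw [← map_pow] at h1
  have h2 : w ^ 2 = 1 := h (by rw [h1, map_one])
  exact (pow_eq_one_iff_left two_ne_zero).1 h2

theorem continuous_coe_sl : Continuous (fun g : SL2R => (g : Matrix (Fin 2) (Fin 2) ℝ)) :=
  continuous_induced_dom

theorem continuous_entry (i j : Fin 2) : Continuous (fun g : SL2R => g i j) :=
  continuous_coe_sl.matrix_elem i j

theorem continuousMul_sl : ContinuousMul SL2R := by
  refine ⟨continuous_induced_rng.2 ?_⟩
  exact (continuous_coe_sl.comp continuous_fst).matrix_mul (continuous_coe_sl.comp continuous_snd)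

/-- Rotation matrices. -/
noncomputable def rot (x : ℝ) : SL2R :=
  ⟨!![Real.cos x, -Real.sin x; Real.sin x, Real.cos x], by
    rw [Matrix.det_fin_two_of]; nlinarith [Real.sin_sq_add_cos_sq x]⟩

theorem rot_pow (x : ℝ) (n : ℕ) : rot x ^ n = rot (n * x) := by
  induction n with
  | zero =>
    rw [pow_zero, Nat.cast_zero, zero_mul]
    apply Subtype.ext
    ext i j
    fin_cases i <;> fin_cases j <;> simp [rot]
  | succ n ih =>
    have h : ((n + 1 : ℕ) : ℝ) * x = n * x + x := by push_cast; ring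
    rw [pow_succ, ih, h]
    apply Subtype.ext
    change (rot (n * x)).1 * (rot x).1 = _
    ext i j
    rw [Matrix.mul_apply, Fin.sum_univ_two]
    fin_cases i <;> fin_cases j <;>
      simp [rot, Real.cos_add, Real.sin_add] <;> ring

/-- Entries of all lifts of elements of a finitely generated `H` lie in a finitely generated ring. -/
theorem entries_fg (H : Subgroup PSL2R) (hfg : H.FG) : ∃ A : Subalgebra ℤ ℝ, A.FG ∧
    ∀ g : SL2R, (QuotientGroup.mk g : PSL2R) ∈ H → ∀ i j, g i j ∈ A := by
  obtain ⟨S, hS⟩ := hfg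
  let E : Set ℝ := (fun q : PSL2R × Fin 2 × Fin 2 => (Quotient.out q.1 : SL2R) q.2.1 q.2.2) ''
    ((S : Set PSL2R) ×ˢ Set.univ)
  have hE : E.Finite := (S.finite_toSet.prod Set.finite_univ).image _
  let A : Subalgebra ℤ ℝ := Algebra.adjoin ℤ E
  refine ⟨A, Subalgebra.fg_def.2 ⟨E, hE, rfl⟩, ?_⟩
  let T : Subgroup SL2R :=
    { carrier := {g | ∀ i j, g i j ∈ A}
      one_mem' := by
        intro i j
        by_cases h : i = j
        · subst h; simp
        · simp [Matrix.one_apply_ne h]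
      mul_mem' := by
        intro a b ha hb i j
        rw [Matrix.SpecialLinearGroup.coe_mul, Matrix.mul_apply]
        exact A.sum_mem fun l _ => A.mul_mem (ha _ _) (hb _ _)
      inv_mem' := by
        intro a ha i j
        rw [Matrix.SpecialLinearGroup.SL2_inv_expl]
        fin_cases i <;> fin_cases j
        · exact ha 1 1
        · exact A.neg_mem (ha 0 1)
        · exact A.neg_mem (ha 1 0)
        · exact ha 0 0 }
  have hcen : Subgroup.center SL2R ≤ T := by
    intro g hg
    obtain ⟨r, hr, hg⟩ := Matrix.SpecialLinearGroup.mem_center_iff.1 hg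
    intro i j
    rw [← hg]
    simp at hr
    rcases hr with rfl | rfl <;> fin_cases i <;> fin_cases j <;> simp
  have hle : H ≤ T.map (QuotientGroup.mk' (Subgroup.center SL2R)) := by
    rw [← hS, Subgroup.closure_le]
    intro x hx
    refine ⟨Quotient.out x, ?_, Quotient.out_eq x⟩
    intro i j
    exact Algebra.subset_adjoin ⟨(x, i, j), ⟨hx, Set.mem_univ _⟩, rfl⟩
  intro g hg
  obtain ⟨t, ht, htg⟩ := hle hg
  have h1 : t⁻¹ * g ∈ Subgroup.center SL2R := QuotientGroup.eq.1 htg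
  have h2 : g ∈ T := by
    have := T.mul_mem ht (hcen h1)
    rwa [mul_inv_cancel_left] at this
  exact h2

theorem elliptic_pow (a : SL2R) (t s : ℝ) (ht : a 0 0 + a 1 1 = 2 * t) (hs : s ≠ 0)
    (hts : t ^ 2 + s ^ 2 = 1) (n : ℕ) :
    ((a ^ n : SL2R) : Matrix (Fin 2) (Fin 2) ℝ) = ((⟨t, s⟩ : ℂ) ^ n).re • 1 +
      (((⟨t, s⟩ : ℂ) ^ n).im / s) • ((a : Matrix (Fin 2) (Fin 2) ℝ) - t • 1) := by
  have hdet : a 0 0 * a 1 1 - a 0 1 * a 1 0 = 1 := by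
    have := a.2
    rwa [Matrix.det_fin_two] at this
  induction n with
  | zero => simp
  | succ n ih =>
    rw [pow_succ, Matrix.SpecialLinearGroup.coe_mul, ih, pow_succ, Complex.mul_re, Complex.mul_im]
    generalize ((⟨t, s⟩ : ℂ) ^ n).re = x
    generalize ((⟨t, s⟩ : ℂ) ^ n).im = y
    have h1 : a 1 1 = 2 * t - a 0 0 := by linarith
    rw [h1] at hdet
    ext i j
    fin_cases i <;> fin_cases j <;>
      simp [Matrix.mul_apply, Fin.sum_univ_two, h1] <;> field_simp
    · linear_combination (-y) * hdet + y * hts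
    · ring
    · ring
    · linear_combination (-y) * hdet + y * hts

theorem dense_fg_subgroup_has_small_free_subgroup (H : Subgroup PSL2R)
    (hfg : H.FG) (hd : Dense (H : Set PSL2R)) :
    ∀ U ∈ nhds (1 : PSL2R), ∃ a ∈ H, ∃ b ∈ H, a ∈ U ∧ b ∈ U ∧
      Function.Injective
        ⇑(FreeGroup.lift (fun x : Bool => if x then a else b) : FreeGroup Bool →* PSL2R) := by
  intro U hU
  have := continuousMul_sl
  have hcont : Continuous (fun g : SL2R => (QuotientGroup.mk g : PSL2R)) :=
    QuotientGroup.continuous_mk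
  have hdense : Dense {g : SL2R | (QuotientGroup.mk g : PSL2R) ∈ H} :=
    hd.preimage QuotientGroup.isOpenMap_coe
  obtain ⟨A, hA, hHA⟩ := entries_fg H hfg
  obtain ⟨M, hM, htors⟩ := bounded_torsion A hA
  have ho1 : IsOpen {g : SL2R | (g 0 0 + g 1 1) ^ 2 < 4} :=
    isOpen_lt (((continuous_entry 0 0).add (continuous_entry 1 1)).pow 2) continuous_const
  have ho2 : IsOpen {g : SL2R | (g : Matrix (Fin 2) (Fin 2) ℝ) ^ M ≠ 1} :=
    isOpen_ne_fun (continuous_coe_sl.pow M) continuous_const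
  -- an elliptic element of infinite order
  obtain ⟨a, ⟨hatr, haM⟩, haH⟩ := hdense.inter_open_nonempty
    {g : SL2R | (g 0 0 + g 1 1) ^ 2 < 4 ∧ (g : Matrix (Fin 2) (Fin 2) ℝ) ^ M ≠ 1}
    (ho1.inter ho2)
    (by
      refine ⟨rot (1 / M), ?_, ?_⟩
      · have h1 : 0 < Real.sin (1 / M) := by
          apply Real.sin_pos_of_pos_of_lt_pi (by positivity)
          have : (1 : ℝ) / M ≤ 1 := by
            rw [div_le_one (by positivity)]
            exact_mod_cast hM
          linarith [Real.pi_gt_three]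
        have h2 := Real.sin_sq_add_cos_sq (1 / M)
        change (Real.cos (1 / M) + Real.cos (1 / M)) ^ 2 < 4
        nlinarith
      · intro h
        rw [← Matrix.SpecialLinearGroup.coe_pow, rot_pow] at h
        have h1 := congrFun (congrFun h 1) 0
        have h2 : (M : ℝ) * (1 / M) = 1 := by field_simp
        rw [h2] at h1
        have h3 : Real.sin 1 = 0 := by simpa [rot] using h1
        have := Real.sin_pos_of_pos_of_lt_pi one_pos (by linarith [Real.pi_gt_three])
        linarith)
  change (QuotientGroup.mk a : PSL2R) ∈ H at haH
  have hinf : ∀ n, 0 < n → a ^ n ≠ 1 := by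
    intro n hn h
    apply haM
    rw [← Matrix.SpecialLinearGroup.coe_pow, htors a (hHA a haH) n hn h]
    rfl
  let t : ℝ := (a 0 0 + a 1 1) / 2
  let s : ℝ := Real.sqrt (1 - t ^ 2)
  have htr : a 0 0 + a 1 1 = 2 * t := by simp only [t]; ring
  have ht1 : 0 < 1 - t ^ 2 := by rw [htr] at hatr; nlinarith
  have hs : s ≠ 0 := (Real.sqrt_pos.2 ht1).ne'
  have hts : t ^ 2 + s ^ 2 = 1 := by rw [Real.sq_sqrt ht1.le]; ring
  let z : ℂ := ⟨t, s⟩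
  have hzc : z * ⟨t, -s⟩ = 1 := by
    apply Complex.ext
    · simp [z]; nlinarith
    · simp [z]; ring
  have hz0 : z ≠ 0 := left_ne_zero_of_mul_eq_one hzc
  have hzinv : z⁻¹ = ⟨t, -s⟩ := inv_eq_of_mul_eq_one_right hzc
  have hpow := elliptic_pow a t s htr hs hts
  have hzroot : ∀ n : ℕ, 0 < n → z ^ n ≠ 1 := by
    intro n hn h
    apply hinf n hn
    apply Subtype.ext
    rw [hpow n]
    change (z ^ n).re • 1 + ((z ^ n).im / s) • _ = _
    rw [h]
    simp
  have hdet : a 0 0 * a 1 1 - a 0 1 * a 1 0 = 1 := by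
    have := a.2
    rwa [Matrix.det_fin_two] at this
  have hc : a 1 0 ≠ 0 := by
    intro h
    rw [h] at hdet
    nlinarith [sq_nonneg (a 0 0 - a 1 1)]
  obtain ⟨v, hv⟩ := exists_absoluteValue z hz0 hzroot
  -- a conjugating element in general position
  obtain ⟨h, ⟨hh1, hh2⟩, hhH⟩ := hdense.inter_open_nonempty
    {g : SL2R | g 0 0 + g 1 1 ≠ 0 ∧ a 1 0 * (g 0 0 - g 1 1) + g 1 0 * (a 1 1 - a 0 0) ≠ 0}
    (IsOpen.inter
      (isOpen_ne_fun ((continuous_entry 0 0).add (continuous_entry 1 1)) continuous_const)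
      (isOpen_ne_fun ((continuous_const.mul ((continuous_entry 0 0).sub (continuous_entry 1 1))).add
        ((continuous_entry 1 0).mul continuous_const)) continuous_const))
    (by
      refine ⟨⟨!![2, 0; 0, 1 / 2], by rw [Matrix.det_fin_two_of]; norm_num⟩, ?_, ?_⟩
      · change (2 : ℝ) + 1 / 2 ≠ 0
        norm_num
      · change a 1 0 * ((2 : ℝ) - 1 / 2) + 0 * (a 1 1 - a 0 0) ≠ 0
        rw [zero_mul, add_zero]
        exact mul_ne_zero hc (by norm_num))
  change (QuotientGroup.mk h : PSL2R) ∈ H at hhH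
  obtain ⟨n₀, hfree⟩ := free_pow a h z v hv
    (by
      have h1 : ((a 0 0 : ℂ) + a 1 1) = ((2 * t : ℝ) : ℂ) := by rw [← htr]; push_cast; rfl
      rw [h1]
      apply Complex.ext
      · simp [z]; nlinarith
      · simp [z]; ring)
    hc
    (by
      rw [hzinv]
      intro h1
      have := congrArg Complex.im h1
      simp only [z] at this
      apply hs
      linarith)
    (by
      have ha11 : a 1 1 = 2 * t - a 0 0 := by linarith
      rw [ha11] at hh2
      rw [hzinv]
      have hA1 : ∀ e : ℝ, e ≠ 0 →
          e * (a 1 0 * (h 0 0 - h 1 1) + h 1 0 * (2 * t - a 0 0 - a 0 0)) ≠ 0 :=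
        fun e he => mul_ne_zero he hh2
      have hA2 : ∀ e : ℝ, e ≠ 0 → e * (a 1 0 * (h 0 0 + h 1 1)) ≠ 0 :=
        fun e he => mul_ne_zero he (mul_ne_zero hc hh1)
      rintro m (rfl | rfl) m' (rfl | rfl) hcon
      · have := congrArg Complex.im hcon
        simp [z] at this
        exact hA1 s hs (by linear_combination this)
      · have := congrArg Complex.im hcon
        simp [z] at this
        exact hA2 s hs (by linear_combination -this)
      · have := congrArg Complex.im hcon
        simp [z] at this
        exact hA2 s hs (by linear_combination this)
      · have := congrArg Complex.im hcon
        simp [z] at this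
        exact hA1 s hs (by linear_combination -this))
  -- recurrence
  have hU' : {g : SL2R | (QuotientGroup.mk g : PSL2R) ∈ U ∧
      (QuotientGroup.mk (h * g * h⁻¹) : PSL2R) ∈ U} ∈ nhds (1 : SL2R) := by
    refine Filter.inter_mem ?_ ?_
    · exact hcont.continuousAt.preimage_mem_nhds hU
    · have hc2 : Continuous (fun g : SL2R => (QuotientGroup.mk (h * g * h⁻¹) : PSL2R)) :=
        hcont.comp ((continuous_const.mul continuous_id).mul continuous_const)
      apply hc2.continuousAt.preimage_mem_nhds
      rw [mul_one, mul_inv_cancel]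
      exact hU
  rw [nhds_induced, Filter.mem_comap] at hU'
  obtain ⟨W, hW, hWU⟩ := hU'
  let ψ : Circle → Matrix (Fin 2) (Fin 2) ℝ := fun c =>
    (c : ℂ).re • 1 + ((c : ℂ).im / s) • ((a : Matrix (Fin 2) (Fin 2) ℝ) - t • 1)
  have hψ : Continuous ψ := by
    have h1 : Continuous fun c : Circle => (c : ℂ).re :=
      Complex.continuous_re.comp continuous_subtype_val
    have h2 : Continuous fun c : Circle => (c : ℂ).im :=
      Complex.continuous_im.comp continuous_subtype_val
    exact (h1.smul continuous_const).add ((h2.div_const s).smul continuous_const)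
  have hψW : ψ ⁻¹' W ∈ nhds (1 : Circle) := by
    apply hψ.continuousAt.preimage_mem_nhds
    have : ψ 1 = ((1 : SL2R) : Matrix (Fin 2) (Fin 2) ℝ) := by simp [ψ]
    rw [this]
    exact hW
  have hzn : ‖z‖ = 1 := by
    have : ‖z‖ ^ 2 = 1 := by
      rw [Complex.sq_norm, Complex.normSq_apply]
      simp only [z]; nlinarith
    nlinarith [norm_nonneg z]
  let ζ : Circle := ⟨z, mem_sphere_zero_iff_norm.2 hzn⟩
  have hfr := (mapClusterPt_one_atTop_pow ζ).frequently hψW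
  obtain ⟨n, hn, hnW⟩ := (Filter.frequently_atTop.1 hfr) n₀
  have hψn : ψ (ζ ^ n) = ((a ^ n : SL2R) : Matrix (Fin 2) (Fin 2) ℝ) := by
    rw [hpow n]
    simp only [ψ, Circle.coe_pow]
    rfl
  have hanW : ((a ^ n : SL2R) : Matrix (Fin 2) (Fin 2) ℝ) ∈ W := by
    rw [← hψn]; exact hnW
  obtain ⟨hu1, hu2⟩ := hWU hanW
  have hm1 : (QuotientGroup.mk (a ^ n) : PSL2R) ∈ H := H.pow_mem haH n
  have hm2 : (QuotientGroup.mk (h * a ^ n * h⁻¹) : PSL2R) ∈ H :=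
    H.mul_mem (H.mul_mem hhH hm1) (H.inv_mem hhH)
  exact ⟨_, hm1, _, hm2, hu1, hu2, psl_free _ _ (hfree n hn)⟩
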